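/- Let w∈A_∞(ℝ^{n₁}×ℝ^{n₂}). There exists a constant η>0 (depending on w) such that sup_{R∈ℛ}(1/w(R))∫_R exp(|f(x)−f_{w,R}|/(η‖f‖_{bmo_w})) w(x)dx < ∞ for all f∈bmo_w with ‖f‖_{bmo_w}>0. -/

import Mathlib

open MeasureTheory ENNReal Set

noncomputable section

namespace JNW

variable {Y : Type*} [MeasurableSpace Y] {F : Type*}

/-- The Hölder conjugate exponent `p' = p/(p-1)`. -/
def conj (p : ℝ) : ℝ := p / (p - 1)

/-- The average `(1/μ(B)) ∫_B g dμ` of an `ℝ≥0∞`-valued function over a set. -/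
def lavg (μ : Measure Y) (B : Set Y) (g : Y → ℝ≥0∞) : ℝ≥0∞ :=
  (∫⁻ x in B, g x ∂μ) / μ B

/-- The Muckenhoupt `A_p` characteristic of a weight `w` relative to the basis `ℬ`:
`[w]_{A_p} = sup_{B ∈ ℬ} ((1/μ(B))∫_B w dμ) ((1/μ(B))∫_B w^{-p'/p} dμ)^{p/p'}`. -/
def apConst (μ : Measure Y) (ℬ : Set (Set Y)) (p : ℝ) (w : Y → ℝ≥0∞) : ℝ≥0∞ :=
  ⨆ B ∈ ℬ, lavg μ B w * (lavg μ B fun x => w x ^ (-(conj p / p))) ^ (p / conj p)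

/-- Membership in the Muckenhoupt class `A_p(ℬ)`: a nonnegative, locally `μ`-integrable
(measurable) function with finite `A_p` characteristic. -/
def MemAp (μ : Measure Y) (ℬ : Set (Set Y)) (p : ℝ) (w : Y → ℝ≥0∞) : Prop :=
  Measurable w ∧ (∀ B ∈ ℬ, ∫⁻ x in B, w x ∂μ < ⊤) ∧ apConst μ ℬ p w < ⊤

/-- `A_∞(ℬ)` is the union of the classes `A_p(ℬ)` over `1 < p < ∞`. -/
def MemAinfty (μ : Measure Y) (ℬ : Set (Set Y)) (w : Y → ℝ≥0∞) : Prop :=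
  ∃ p : ℝ, 1 < p ∧ MemAp μ ℬ p w

/-- The reverse Hölder characteristic `[w]_{RH_δ}`: the least constant `C` with
`((1/μ(B))∫_B w^δ dμ)^{1/δ} ≤ C (1/μ(B))∫_B w dμ` for all `B ∈ ℬ`. -/
def rhConst (μ : Measure Y) (ℬ : Set (Set Y)) (δ : ℝ) (w : Y → ℝ≥0∞) : ℝ≥0∞ :=
  ⨆ B ∈ ℬ, (lavg μ B fun x => w x ^ δ) ^ (1 / δ) / lavg μ B w

/-- Membership in the reverse Hölder class `RH_δ(ℬ)`. -/
def MemRH (μ : Measure Y) (ℬ : Set (Set Y)) (δ : ℝ) (w : Y → ℝ≥0∞) : Prop :=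
  Measurable w ∧ (∀ B ∈ ℬ, ∫⁻ x in B, w x ∂μ < ⊤) ∧ rhConst μ ℬ δ w < ⊤

/-- The weight identically equal to one. -/
def wone : Y → ℝ≥0∞ := fun _ => 1

/-- `‖f‖_{X_w^p} = (sup_{B∈ℬ} (1/w(B)) ∫_B Λ(f,B)(x)^p w(x) dμ(x))^(1/p)`. -/
def xNorm (μ : Measure Y) (ℬ : Set (Set Y)) (Λ : F → Set Y → Y → ℝ≥0∞)
    (w : Y → ℝ≥0∞) (p : ℝ) (f : F) : ℝ≥0∞ :=
  (⨆ B ∈ ℬ, (∫⁻ x in B, Λ f B x ^ p * w x ∂μ) / ∫⁻ x in B, w x ∂μ) ^ (1 / p)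

/-- The `p`-power John–Nirenberg property of `X_w(ℬ,Λ)` on an interval `I ⊆ (0,∞)`:
for all `p < q` in `I` there is a finite constant `C` with `‖f‖_{X_w^q} ≤ C ‖f‖_{X_w^p}`
for every `f ∈ X_w(ℬ,Λ)`. -/
def JNprop (μ : Measure Y) (ℬ : Set (Set Y)) (Λ : F → Set Y → Y → ℝ≥0∞)
    (w : Y → ℝ≥0∞) (I : Set ℝ) : Prop :=
  ∀ p ∈ I, ∀ q ∈ I, p < q → ∃ C : ℝ≥0∞, C < ⊤ ∧
    ∀ f : F, xNorm μ ℬ Λ w 1 f < ⊤ → xNorm μ ℬ Λ w q f ≤ C * xNorm μ ℬ Λ w p f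

/-- `c_{p,q}(w)`: the least constant `C` with `‖f‖_{X_w^q} ≤ C ‖f‖_{X_w^p}` for all
`f ∈ X_w(ℬ,Λ)`. -/
def cConst (μ : Measure Y) (ℬ : Set (Set Y)) (Λ : F → Set Y → Y → ℝ≥0∞)
    (w : Y → ℝ≥0∞) (p q : ℝ) : ℝ≥0∞ :=
  sInf {C : ℝ≥0∞ |
    ∀ f : F, xNorm μ ℬ Λ w 1 f < ⊤ → xNorm μ ℬ Λ w q f ≤ C * xNorm μ ℬ Λ w p f}

/-- `b_{w,v}`: the least constant `C` with `‖f‖_{X_v} ≤ C ‖f‖_{X_w}` for all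
`f ∈ X_w(ℬ,Λ)`. -/
def bConst (μ : Measure Y) (ℬ : Set (Set Y)) (Λ : F → Set Y → Y → ℝ≥0∞)
    (w v : Y → ℝ≥0∞) : ℝ≥0∞ :=
  sInf {C : ℝ≥0∞ |
    ∀ f : F, xNorm μ ℬ Λ w 1 f < ⊤ → xNorm μ ℬ Λ v 1 f ≤ C * xNorm μ ℬ Λ w 1 f}

/-- The weight invariance property of `X(ℬ,Λ)` for a class `𝒲` of weights:
`X_w(ℬ,Λ) = X_v(ℬ,Λ)` as sets for all `w, v ∈ 𝒲`, with a finite comparison constant. -/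
def WeightInv (μ : Measure Y) (ℬ : Set (Set Y)) (Λ : F → Set Y → Y → ℝ≥0∞)
    (𝒲 : Set (Y → ℝ≥0∞)) : Prop :=
  ∀ w ∈ 𝒲, ∀ v ∈ 𝒲,
    ({f : F | xNorm μ ℬ Λ w 1 f < ⊤} = {f : F | xNorm μ ℬ Λ v 1 f < ⊤}) ∧
    ∃ C : ℝ≥0∞, C < ⊤ ∧
      ∀ f : F, xNorm μ ℬ Λ w 1 f < ⊤ → xNorm μ ℬ Λ v 1 f ≤ C * xNorm μ ℬ Λ w 1 f

/-- `Ψ_p(t) = sup { b_{1,v} : v ∈ A_p(ℬ), [v]_{A_p} ≤ t }`. -/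
def psi (μ : Measure Y) (ℬ : Set (Set Y)) (Λ : F → Set Y → Y → ℝ≥0∞)
    (p : ℝ) (t : ℝ≥0∞) : ℝ≥0∞ :=
  ⨆ (v : Y → ℝ≥0∞) (_ : MemAp μ ℬ p v ∧ apConst μ ℬ p v ≤ t),
    bConst μ ℬ Λ wone v

end JNW
namespace JNW

/-- An axis-parallel cube in `ℝⁿ`. -/
def isCube {n : ℕ} (Q : Set (Fin n → ℝ)) : Prop :=
  ∃ (a : Fin n → ℝ) (h : ℝ), 0 < h ∧ Q = Set.univ.pi fun i => Set.Ioc (a i) (a i + h)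

/-- The collection `ℛ(ℝ^{n₁} × ℝ^{n₂})` of rectangles `R = Q₁ × Q₂` with `Q₁ ⊆ ℝ^{n₁}`,
`Q₂ ⊆ ℝ^{n₂}` cubes. -/
def rects (n₁ n₂ : ℕ) : Set (Set ((Fin n₁ → ℝ) × (Fin n₂ → ℝ))) :=
  {R | ∃ (Q₁ : Set (Fin n₁ → ℝ)) (Q₂ : Set (Fin n₂ → ℝ)),
    isCube Q₁ ∧ isCube Q₂ ∧ R = Q₁ ×ˢ Q₂}

/-- `‖f‖_{bmo_w}`: the little-bmo norm with respect to the weight `w`,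
`sup_{R∈ℛ} (1/w(R)) ∫_R |f - f_{w,R}| w dx`. -/
def bmoRectWNorm (n₁ n₂ : ℕ) (w : (Fin n₁ → ℝ) × (Fin n₂ → ℝ) → ℝ≥0∞)
    (f : (Fin n₁ → ℝ) × (Fin n₂ → ℝ) → ℂ) : ℝ≥0∞ :=
  ⨆ R ∈ rects n₁ n₂,
    (∫⁻ x in R, (‖f x - ⨍ y in R, f y ∂(volume.withDensity w)‖₊ : ℝ≥0∞) * w x) /
      ∫⁻ x in R, w x

end JNW
namespace JNW

/-- Sums of `exp (l * ‖avg - c‖)`, weighted by `m`, over the `n`-th generation below a node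
of a tree. -/
def expSum {I ι : Type*} [Fintype ι] (child : I → ι → I) (m : I → ℝ) (avg : I → ℂ) (l : ℝ) :
    ℕ → I → ℂ → ℝ
  | 0, t, c => Real.exp (l * ‖avg t - c‖) * m t
  | n + 1, t, c => ∑ i, expSum child m avg l n (child t i) c

section Tree

variable {I ι : Type*} [Fintype ι] {child : I → ι → I} {m : I → ℝ} {avg : I → ℂ} {l : ℝ}

lemma expSum_le_exp_mul (hl : 0 ≤ l) (hm : ∀ t, 0 ≤ m t) (n : ℕ) (t : I) (c c' : ℂ) :
    expSum child m avg l n t c ≤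
      Real.exp (l * ‖c' - c‖) * expSum child m avg l n t c' := by
  induction n generalizing t with
  | zero =>
    simp only [expSum]
    rw [← mul_assoc, ← Real.exp_add]
    refine mul_le_mul_of_nonneg_right (Real.exp_le_exp.2 ?_) (hm t)
    rw [← mul_add]
    refine mul_le_mul_of_nonneg_left ?_ hl
    have h := norm_add_le (c' - c) (avg t - c')
    rwa [show c' - c + (avg t - c') = avg t - c by ring] at h
  | succ n ih =>
    simp only [expSum, Finset.mul_sum]
    exact Finset.sum_le_sum fun i _ => ih _

/-- The discrete John–Nirenberg inequality on a tree whose averages have jumps at most `C * B`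
and mean oscillation at most `B`. -/
lemma expSum_le {osc : I → ℂ → ℝ} {B C : ℝ} (hB : 0 < B) (hC : 0 ≤ C)
    (hm : ∀ t, 0 ≤ m t) (hmsum : ∀ t, m t = ∑ i, m (child t i))
    (hosc : ∀ t c, osc t c = ∑ i, osc (child t i) c)
    (hosc_le : ∀ t c, m t * ‖avg t - c‖ ≤ osc t c)
    (hBMO : ∀ t, osc t (avg t) ≤ B * m t)
    (hjump : ∀ t i, ‖avg (child t i) - avg t‖ ≤ C * B)
    (hl : l * (3 * (2 + C) * B) = 1) (n : ℕ) (t : I) :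
    expSum child m avg l n t (avg t) ≤ 4 * Real.exp (l * (2 * B)) * m t := by
  have hden : 0 < 3 * (2 + C) * B := by positivity
  have hl0 : 0 < l := by
    by_contra! h
    nlinarith
  have hosc0 : ∀ t c, 0 ≤ osc t c := fun t c =>
    (mul_nonneg (hm t) (norm_nonneg _)).trans (hosc_le t c)
  set b := Real.exp (l * (2 * B)) with hb
  have hb0 : 0 < b := Real.exp_pos _
  have hexp : Real.exp (l * (2 * B + C * B)) ≤ 3 / 2 := by
    have h1 : l * (2 * B + C * B) = 1 / 3 := by linarith
    rw [h1]
    have h2 : Real.exp (1 / 3) ^ 3 = Real.exp 1 := by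
      rw [← Real.exp_nat_mul]; norm_num
    by_contra! h
    have h3 := pow_lt_pow_left₀ h (by norm_num) (n := 3) (by norm_num)
    have h4 := Real.exp_one_lt_d9
    rw [h2] at h3
    norm_num at h3
    linarith
  induction n using Nat.strong_induction_on generalizing t with
  | _ n IH =>
  have key : ∀ j ≤ n, ∀ t c, ‖avg t - c‖ ≤ 2 * B →
      expSum child m avg l j t c ≤ b * m t + 3 * b / B * osc t c := by
    intro j
    induction j with
    | zero =>
      intro _ t c hc
      simp only [expSum]
      have h1 : Real.exp (l * ‖avg t - c‖) ≤ b :=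
        Real.exp_le_exp.2 (mul_le_mul_of_nonneg_left hc hl0.le)
      have h2 := mul_le_mul_of_nonneg_right h1 (hm t)
      have h3 : 0 ≤ 3 * b / B * osc t c := mul_nonneg (by positivity) (hosc0 t c)
      linarith
    | succ j ih =>
      intro hj t c hc
      simp only [expSum]
      rw [hmsum t, hosc t c, Finset.mul_sum, Finset.mul_sum, ← Finset.sum_add_distrib]
      refine Finset.sum_le_sum fun i _ => ?_
      set s := child t i
      by_cases hs : ‖avg s - c‖ ≤ 2 * B
      · exact ih (by omega) s c hs
      · push Not at hs
        have h1 := expSum_le_exp_mul (child := child) (avg := avg) hl0.le hm j s c (avg s)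
        have h2 : ‖avg s - c‖ ≤ 2 * B + C * B := by
          have h := norm_add_le (avg s - avg t) (avg t - c)
          rw [sub_add_sub_cancel] at h
          linarith [hjump t i]
        have h3 : Real.exp (l * ‖avg s - c‖) ≤ 3 / 2 :=
          (Real.exp_le_exp.2 (mul_le_mul_of_nonneg_left h2 hl0.le)).trans hexp
        have h4 := IH j (by omega) s
        have h5 : Real.exp (l * ‖avg s - c‖) * expSum child m avg l j s (avg s) ≤
            3 / 2 * (4 * b * m s) :=
          (mul_le_mul_of_nonneg_left h4 (Real.exp_pos _).le).trans
            (mul_le_mul_of_nonneg_right h3 (mul_nonneg (by positivity) (hm s)))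
        have h6 : m s * (2 * B) ≤ osc s c :=
          (mul_le_mul_of_nonneg_left hs.le (hm s)).trans (hosc_le s c)
        have h7 : 3 / 2 * (4 * b * m s) ≤ 3 * b / B * osc s c := by
          calc 3 / 2 * (4 * b * m s) = 3 * b / B * (m s * (2 * B)) := by field_simp; ring
            _ ≤ _ := mul_le_mul_of_nonneg_left h6 (by positivity)
        have h8 : 0 ≤ b * m s := mul_nonneg hb0.le (hm s)
        linarith
  have h1 := key n le_rfl t (avg t) (by simp; positivity)
  have h2 : 3 * b / B * osc t (avg t) ≤ 3 * b / B * (B * m t) :=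
    mul_le_mul_of_nonneg_left (hBMO t) (by positivity)
  have h3 : 3 * b / B * (B * m t) = 3 * b * m t := by field_simp
  linarith

end Tree

/-- The `A_p` condition bounds the weight of a set by that of a subset of comparable size. -/
lemma weight_le_of_apConst {Y : Type*} [MeasurableSpace Y] {μ : Measure Y} {w : Y → ℝ≥0∞}
    (hw : Measurable w) {p : ℝ} (hp : 1 < p) {R E : Set Y} (hER : E ⊆ R)
    {N A : ℝ≥0∞} (hN : μ R = N * μ E)
    (hE0 : μ E ≠ 0) (hR : μ R ≠ ⊤) (hwR : ∫⁻ x in R, w x ∂μ < ⊤)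
    (hA : (∫⁻ x in R, w x ∂μ) / μ R *
      ((∫⁻ x in R, w x ^ (-((p / (p - 1)) / p)) ∂μ) / μ R) ^ (p / (p / (p - 1))) ≤ A)
    (hAtop : A ≠ ⊤) :
    ∫⁻ x in R, w x ∂μ ≤ A * N ^ p * ∫⁻ x in E, w x ∂μ := by
  have hp0 : 0 < p := by linarith
  have hp1 : 0 < p - 1 := by linarith
  have e1 : (p / (p - 1)) / p = 1 / (p - 1) := by field_simp
  have e2 : p / (p / (p - 1)) = p - 1 := by field_simp
  rw [e1, e2] at hA
  set S := ∫⁻ x in R, w x ^ (-(1 / (p - 1))) ∂μ with hS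
  set W := ∫⁻ x in R, w x ∂μ with hW
  by_cases hW0 : W = 0
  · simp [hW0]
  have hE : μ E ≠ ⊤ := ne_top_of_le_ne_top hR (measure_mono hER)
  have hR0 : μ R ≠ 0 := fun h => hE0 (measure_mono_null hER h)
  have hStop : S ≠ ⊤ := by
    intro h
    rw [h, ENNReal.top_div_of_ne_top hR, ENNReal.top_rpow_of_pos hp1,
      ENNReal.mul_top (ENNReal.div_ne_zero.2 ⟨hW0, hR⟩)] at hA
    exact hAtop (top_le_iff.1 hA)
  have hWS : W * S ^ (p - 1) ≤ A * μ R ^ p := by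
    have h1 : W / μ R * (S / μ R) ^ (p - 1) = W * S ^ (p - 1) / μ R ^ p := by
      rw [ENNReal.div_rpow_of_nonneg _ _ hp1.le, ENNReal.div_eq_inv_mul, ENNReal.div_eq_inv_mul,
        ENNReal.div_eq_inv_mul]
      have h2 : (μ R ^ p)⁻¹ = (μ R)⁻¹ * (μ R ^ (p - 1))⁻¹ := by
        rw [← ENNReal.mul_inv (Or.inl hR0) (Or.inl hR)]
        congr 1
        nth_rw 2 [← ENNReal.rpow_one (μ R)]
        rw [← ENNReal.rpow_add _ _ hR0 hR]
        congr 1; ring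
      rw [h2]; ring
    rw [h1] at hA
    exact (ENNReal.div_le_iff (by positivity) (by finiteness)).1 hA
  have hae : ∀ᵐ x ∂(μ.restrict E), 1 ≤ w x ^ (1 / p) * w x ^ (-(1 / p)) := by
    have h1 : ∀ᵐ x ∂(μ.restrict R), w x < ⊤ := ae_lt_top hw hwR.ne
    have h2 : ∀ᵐ x ∂(μ.restrict R), w x ^ (-(1 / (p - 1))) < ⊤ :=
      ae_lt_top (hw.pow_const _) hStop
    filter_upwards [ae_restrict_of_ae_restrict_of_subset hER h1,
      ae_restrict_of_ae_restrict_of_subset hER h2] with x hx1 hx2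
    have hx0 : w x ≠ 0 := by
      intro h
      rw [h, ENNReal.zero_rpow_of_neg (by rw [neg_lt_zero]; positivity)] at hx2
      exact hx2.ne rfl
    rw [← ENNReal.rpow_add _ _ hx0 hx1.ne]
    simp
  have hpq : p.HolderConjugate (p / (p - 1)) := Real.HolderConjugate.conjExponent hp
  have hH : μ E ≤ (∫⁻ x in E, w x ∂μ) ^ (1 / p) * S ^ (1 / (p / (p - 1))) := by
    calc μ E = ∫⁻ x in E, 1 ∂μ := by simp
      _ ≤ ∫⁻ x in E, w x ^ (1 / p) * w x ^ (-(1 / p)) ∂μ := lintegral_mono_ae hae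
      _ ≤ (∫⁻ x in E, (w x ^ (1 / p)) ^ p ∂μ) ^ (1 / p) *
          (∫⁻ x in E, (w x ^ (-(1 / p))) ^ (p / (p - 1)) ∂μ) ^ (1 / (p / (p - 1))) :=
        ENNReal.lintegral_mul_le_Lp_mul_Lq _ hpq (hw.pow_const _).aemeasurable
          (hw.pow_const _).aemeasurable
      _ ≤ _ := by
        have h1 : ∀ x, (w x ^ (1 / p)) ^ p = w x := fun x => by
          rw [← ENNReal.rpow_mul, one_div_mul_cancel hp0.ne', ENNReal.rpow_one]
        have h2 : ∀ x, (w x ^ (-(1 / p))) ^ (p / (p - 1)) = w x ^ (-(1 / (p - 1))) := fun x => by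
          rw [← ENNReal.rpow_mul]; congr 1; field_simp
        simp only [h1, h2]
        gcongr
        exact lintegral_mono_set hER
  have hH' : μ E ^ p ≤ (∫⁻ x in E, w x ∂μ) * S ^ (p - 1) := by
    have h := ENNReal.rpow_le_rpow hH hp0.le
    rw [ENNReal.mul_rpow_of_nonneg _ _ hp0.le, ← ENNReal.rpow_mul, ← ENNReal.rpow_mul,
      one_div_mul_cancel hp0.ne', ENNReal.rpow_one] at h
    convert h using 3
    field_simp
  have hEp0 : μ E ^ p ≠ 0 := by
    simp [ENNReal.rpow_eq_zero_iff, hE0, hE]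
  have hEpt : μ E ^ p ≠ ⊤ := by finiteness
  rw [← ENNReal.mul_le_mul_iff_left hEp0 hEpt]
  calc W * μ E ^ p ≤ W * ((∫⁻ x in E, w x ∂μ) * S ^ (p - 1)) := by gcongr
    _ = (W * S ^ (p - 1)) * ∫⁻ x in E, w x ∂μ := by ring
    _ ≤ A * μ R ^ p * ∫⁻ x in E, w x ∂μ := by gcongr
    _ = _ := by rw [hN, ENNReal.mul_rpow_of_nonneg _ _ hp0.le]; ring

/-- A tree of sets of positive finite measure in which each set is partitioned into its children,
whose diameter bounds are half as large. -/
structure PartitionTree (α : Type*) [PseudoMetricSpace α] [MeasurableSpace α] (ν : Measure α)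
    (I ι : Type*) where
  S : I → Set α
  child : I → ι → I
  size : I → ℝ
  measurableSet (t : I) : MeasurableSet (S t)
  eq_iUnion (t : I) : S t = ⋃ i, S (child t i)
  disjoint (t : I) : Pairwise (Function.onFun Disjoint fun i => S (child t i))
  dist_le (t : I) : ∀ x ∈ S t, ∀ y ∈ S t, dist x y ≤ size t
  size_child (t : I) (i : ι) : size (child t i) = size t / 2
  measure_ne_zero (t : I) : ν (S t) ≠ 0
  measure_ne_top (t : I) : ν (S t) ≠ ⊤

lemma measure_mul_enorm_average_sub_le {α : Type*} [MeasurableSpace α] {ν : Measure α} {s : Set α}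
    (h0 : ν s ≠ 0) (htop : ν s ≠ ⊤) {f : α → ℂ} (hf : IntegrableOn f s ν) (z : ℂ) :
    ν s * ‖(⨍ y in s, f y ∂ν) - z‖ₑ ≤ ∫⁻ y in s, ‖f y - z‖ₑ ∂ν := by
  have hr : ν.real s ≠ 0 := ENNReal.toReal_ne_zero.2 ⟨h0, htop⟩
  have h1 : ∫ y in s, (f y - z) ∂ν = ν.real s • ((⨍ y in s, f y ∂ν) - z) := by
    rw [integral_sub hf (integrableOn_const htop), setIntegral_const, setAverage_eq, smul_sub,
      smul_inv_smul₀ hr]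
  have h2 : ν s * ‖(⨍ y in s, f y ∂ν) - z‖ₑ = ‖∫ y in s, (f y - z) ∂ν‖ₑ := by
    rw [h1, enorm_smul, Real.enorm_eq_ofReal measureReal_nonneg, ofReal_measureReal htop]
  rw [h2]
  exact enorm_integral_le_lintegral_enorm _

namespace PartitionTree

variable {α : Type*} [PseudoMetricSpace α] [MeasurableSpace α] {ν : Measure α}
  {I ι : Type*} [Fintype ι] (D : PartitionTree α ν I ι)

/-- The average of `f` over the sets of the `n`-th generation below `t`. -/
def approx (f : α → ℂ) : ℕ → I → α → ℂ
  | 0, t, _ => ⨍ y in D.S t, f y ∂ν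
  | n + 1, t, x => ∑ i, (D.S (D.child t i)).indicator (approx f n (D.child t i)) x

lemma measurable_approx (f : α → ℂ) (n : ℕ) (t : I) : Measurable (D.approx f n t) := by
  induction n generalizing t with
  | zero => exact measurable_const
  | succ n ih =>
    exact Finset.measurable_fun_sum _ fun i _ => (ih _).indicator (D.measurableSet _)

lemma approx_succ (f : α → ℂ) (n : ℕ) (t : I) (i : ι) {x : α} (hx : x ∈ D.S (D.child t i)) :
    D.approx f (n + 1) t x = D.approx f n (D.child t i) x := by
  rw [approx, Finset.sum_eq_single i, indicator_of_mem hx]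
  · intro j _ hj
    exact indicator_of_notMem (fun h => (D.disjoint t hj).le_bot ⟨h, hx⟩) _
  · simp

lemma setLIntegral_eq_sum (g : α → ℝ≥0∞) (t : I) :
    ∫⁻ x in D.S t, g x ∂ν = ∑ i, ∫⁻ x in D.S (D.child t i), g x ∂ν := by
  conv_lhs => rw [D.eq_iUnion t]
  rw [lintegral_iUnion (fun i => D.measurableSet _) (D.disjoint t), tsum_fintype]

lemma measure_eq_sum (t : I) : ν (D.S t) = ∑ i, ν (D.S (D.child t i)) := by
  simpa using D.setLIntegral_eq_sum 1 t

lemma lintegral_exp_approx (f : α → ℂ) (l : ℝ) (c : ℂ) (n : ℕ) (t : I) :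
    ∫⁻ x in D.S t, ENNReal.ofReal (Real.exp (l * ‖D.approx f n t x - c‖)) ∂ν =
      ENNReal.ofReal (expSum D.child (fun t => ν.real (D.S t))
        (fun t => ⨍ y in D.S t, f y ∂ν) l n t c) := by
  have hnn : ∀ n t, 0 ≤ expSum D.child (fun t => ν.real (D.S t))
      (fun t => ⨍ y in D.S t, f y ∂ν) l n t c := by
    intro n
    induction n with
    | zero => intro t; simp only [expSum]; positivity
    | succ n ih => intro t; exact Finset.sum_nonneg fun i _ => ih _
  induction n generalizing t with
  | zero =>
    simp only [approx, expSum]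
    rw [setLIntegral_const, ENNReal.ofReal_mul (Real.exp_pos _).le,
      ofReal_measureReal (D.measure_ne_top t)]
  | succ n ih =>
    rw [D.setLIntegral_eq_sum, expSum, ENNReal.ofReal_sum_of_nonneg fun i _ => hnn _ _]
    refine Finset.sum_congr rfl fun i _ => ?_
    rw [← ih]
    exact setLIntegral_congr_fun (D.measurableSet _) fun x hx => by
      simp only [D.approx_succ f n t i hx]

lemma lintegral_sub_approx_le {f g : α → ℂ} {ε : ℝ≥0∞}
    (n : ℕ) (t : I) (hf : IntegrableOn f (D.S t) ν)
    (hg : ∀ x y, dist x y ≤ D.size t / 2 ^ n → ‖g x - g y‖ₑ ≤ ε) :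
    ∫⁻ x in D.S t, ‖D.approx f n t x - f x‖ₑ ∂ν ≤
      ε * ν (D.S t) + 2 * ∫⁻ x in D.S t, ‖f x - g x‖ₑ ∂ν := by
  induction n generalizing t with
  | zero =>
    simp only [approx]
    set a := ⨍ y in D.S t, f y ∂ν
    set E := ∫⁻ x in D.S t, ‖f x - g x‖ₑ ∂ν
    have h0 := D.measure_ne_zero t
    have htop := D.measure_ne_top t
    have h1 : ∀ x ∈ D.S t, ‖a - g x‖ₑ ≤ ε + E / ν (D.S t) := by
      intro x hx
      have h2 : ν (D.S t) * ‖a - g x‖ₑ ≤ ε * ν (D.S t) + E := by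
        refine (measure_mul_enorm_average_sub_le h0 htop hf (g x)).trans ?_
        calc ∫⁻ y in D.S t, ‖f y - g x‖ₑ ∂ν ≤ ∫⁻ y in D.S t, (ε + ‖f y - g y‖ₑ) ∂ν := by
              refine setLIntegral_mono' (D.measurableSet t) fun y hy => ?_
              have h3 : f y - g x = (g y - g x) + (f y - g y) := by ring
              rw [h3]
              refine (enorm_add_le _ _).trans ?_
              gcongr
              exact hg y x (by simpa using D.dist_le t y hy x hx)
          _ = _ := by rw [lintegral_add_left measurable_const, setLIntegral_const]
      have h4 : ‖a - g x‖ₑ ≤ (ε * ν (D.S t) + E) / ν (D.S t) := by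
        rw [ENNReal.le_div_iff_mul_le (Or.inl h0) (Or.inl htop), mul_comm]
        exact h2
      rwa [ENNReal.add_div, ENNReal.mul_div_cancel_right h0 htop] at h4
    calc ∫⁻ x in D.S t, ‖a - f x‖ₑ ∂ν
        ≤ ∫⁻ x in D.S t, ((ε + E / ν (D.S t)) + ‖f x - g x‖ₑ) ∂ν := by
          refine setLIntegral_mono' (D.measurableSet t) fun x hx => ?_
          have h3 : a - f x = (a - g x) - (f x - g x) := by ring
          rw [h3]
          refine (enorm_sub_le).trans ?_
          gcongr
          exact h1 x hx
      _ = _ := by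
          rw [lintegral_add_left measurable_const, setLIntegral_const, add_mul,
            ENNReal.div_mul_cancel h0 htop, two_mul, add_assoc]
  | succ n ih =>
    rw [D.setLIntegral_eq_sum _ t, D.setLIntegral_eq_sum (fun x => ‖f x - g x‖ₑ) t,
      D.measure_eq_sum t, Finset.mul_sum, Finset.mul_sum, ← Finset.sum_add_distrib]
    refine Finset.sum_le_sum fun i _ => ?_
    refine le_trans (le_of_eq ?_) (ih (D.child t i) (hf.mono_set ?_) ?_)
    · exact setLIntegral_congr_fun (D.measurableSet _) fun x hx => by
        simp only [D.approx_succ f n t i hx]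
    · rw [D.eq_iUnion t]; exact subset_iUnion (fun i => D.S (D.child t i)) i
    · intro x y h
      refine hg x y (h.trans_eq ?_)
      rw [D.size_child, pow_succ]; field_simp

lemma tendsto_lintegral_sub_approx [SecondCountableTopology α] [LocallyCompactSpace α]
    [BorelSpace α] [CompleteSpace α] {f : α → ℂ} (t : I)
    (hf : IntegrableOn f (D.S t) ν) :
    Filter.Tendsto (fun n => ∫⁻ x in D.S t, ‖D.approx f n t x - f x‖ₑ ∂ν) Filter.atTop
      (nhds 0) := by
  have hfin : IsFiniteMeasure (ν.restrict (D.S t)) :=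
    ⟨by rw [Measure.restrict_apply_univ]; exact (D.measure_ne_top t).lt_top⟩
  rw [ENNReal.tendsto_atTop_zero]
  intro δ hδ
  wlog hδt : δ ≠ ⊤ generalizing δ
  · obtain ⟨N, hN⟩ := this 1 one_pos one_ne_top
    push Not at hδt
    exact ⟨N, fun n _ => by simp [hδt]⟩
  obtain ⟨g, hgc, hg, hgcont, -⟩ :=
    Integrable.exists_hasCompactSupport_lintegral_sub_le hf (ε := δ / 4)
      (ENNReal.div_ne_zero.2 ⟨hδ.ne', by norm_num⟩)
  have hu := hgc.uniformContinuous_of_continuous hgcont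
  have hε0 : 0 < δ / 2 / ν (D.S t) :=
    ENNReal.div_pos (ENNReal.div_ne_zero.2 ⟨hδ.ne', by norm_num⟩) (D.measure_ne_top t)
  obtain ⟨r, hr0, hr⟩ := (EMetric.uniformContinuous_iff.1 hu) _ hε0
  have hlim : Filter.Tendsto (fun n : ℕ => ENNReal.ofReal (D.size t / 2 ^ n)) Filter.atTop
      (nhds 0) := by
    rw [← ENNReal.ofReal_zero]
    refine ENNReal.tendsto_ofReal ?_
    have := (tendsto_pow_atTop_nhds_zero_of_lt_one (r := (1 / 2 : ℝ)) (by norm_num)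
      (by norm_num)).const_mul (D.size t)
    simpa [div_eq_mul_inv] using this
  obtain ⟨N, hN⟩ := Filter.eventually_atTop.1 (hlim.eventually_lt_const hr0)
  refine ⟨N, fun n hn => ?_⟩
  refine (D.lintegral_sub_approx_le n t hf (g := g) (ε := δ / 2 / ν (D.S t))
    fun x y hxy => ?_).trans ?_
  · rw [← edist_eq_enorm_sub]
    refine (hr ?_).le
    rw [edist_dist]
    exact (ENNReal.ofReal_le_ofReal hxy).trans_lt (hN n hn)
  · rw [ENNReal.div_mul_cancel (D.measure_ne_zero t) (D.measure_ne_top t)]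
    calc δ / 2 + 2 * ∫⁻ x in D.S t, ‖f x - g x‖ₑ ∂ν ≤ δ / 2 + 2 * (δ / 4) := by gcongr
      _ = δ / 2 + δ / 2 := by
        congr 1
        rw [show (4 : ℝ≥0∞) = 2 * 2 by norm_num, ← mul_div_assoc,
          ENNReal.mul_div_mul_left _ _ (by norm_num) (by norm_num)]
      _ = δ := ENNReal.add_halves δ

/-- The John–Nirenberg inequality along a partition tree with doubling. -/
theorem lintegral_exp_le [SecondCountableTopology α] [LocallyCompactSpace α]
    [BorelSpace α] [CompleteSpace α] {f : α → ℂ} (hfm : Measurable f)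
    (hf : ∀ t, IntegrableOn f (D.S t) ν) {B C l : ℝ} (hB : 0 < B) (hC : 0 ≤ C)
    (hdoubling : ∀ t i, ν (D.S t) ≤ ENNReal.ofReal C * ν (D.S (D.child t i)))
    (hBMO : ∀ t, ∫⁻ x in D.S t, ‖f x - ⨍ y in D.S t, f y ∂ν‖ₑ ∂ν ≤
      ENNReal.ofReal B * ν (D.S t))
    (hl : l * (3 * (2 + C) * B) = 1) (t : I) :
    ∫⁻ x in D.S t, ENNReal.ofReal (Real.exp (l * ‖f x - ⨍ y in D.S t, f y ∂ν‖)) ∂ν ≤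
      ENNReal.ofReal (4 * Real.exp (l * (2 * B))) * ν (D.S t) := by
  set avg : I → ℂ := fun t => ⨍ y in D.S t, f y ∂ν with havg
  set m : I → ℝ := fun t => ν.real (D.S t) with hmdef
  have hfin : ∀ t c, ∫⁻ x in D.S t, ‖f x - c‖ₑ ∂ν ≠ ⊤ := fun t c =>
    ((hf t).sub (integrableOn_const (D.measure_ne_top t))).2.ne
  have hjump : ∀ t i, ‖avg (D.child t i) - avg t‖ ≤ C * B := by
    intro t i
    set s := D.child t i
    have h1 := measure_mul_enorm_average_sub_le (D.measure_ne_zero s) (D.measure_ne_top s)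
      (hf s) (avg t)
    have hsub : D.S s ⊆ D.S t := by
      rw [D.eq_iUnion t]; exact subset_iUnion (fun i => D.S (D.child t i)) i
    have h2 : ν (D.S s) * ‖avg s - avg t‖ₑ ≤ ν (D.S s) * ENNReal.ofReal (C * B) := by
      calc _ ≤ ∫⁻ x in D.S t, ‖f x - avg t‖ₑ ∂ν := h1.trans (lintegral_mono_set hsub)
        _ ≤ ENNReal.ofReal B * (ENNReal.ofReal C * ν (D.S s)) :=
          (hBMO t).trans (by gcongr; exact hdoubling t i)
        _ = _ := by rw [ENNReal.ofReal_mul hC]; ring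
    have h3 := (ENNReal.mul_le_mul_iff_right (D.measure_ne_zero s) (D.measure_ne_top s)).1 h2
    rw [← ofReal_norm] at h3
    exact (ENNReal.ofReal_le_ofReal_iff (by positivity)).1 h3
  have hbound : ∀ n, ∫⁻ x in D.S t, ENNReal.ofReal (Real.exp (l * ‖D.approx f n t x - avg t‖)) ∂ν
      ≤ ENNReal.ofReal (4 * Real.exp (l * (2 * B))) * ν (D.S t) := by
    intro n
    rw [D.lintegral_exp_approx f l (avg t) n t, ← ofReal_measureReal (D.measure_ne_top t),
      ← ENNReal.ofReal_mul (by positivity)]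
    refine ENNReal.ofReal_le_ofReal ?_
    refine expSum_le (osc := fun t c => (∫⁻ x in D.S t, ‖f x - c‖ₑ ∂ν).toReal) hB hC
      (fun t => measureReal_nonneg) ?_ ?_ ?_ ?_ hjump hl n t
    · intro t
      simp only [Measure.real]
      rw [D.measure_eq_sum t, ENNReal.toReal_sum fun i _ => D.measure_ne_top _]
    · intro t c
      rw [D.setLIntegral_eq_sum, ENNReal.toReal_sum fun i _ => hfin _ _]
    · intro t c
      have h := ENNReal.toReal_mono (hfin t c)
        (measure_mul_enorm_average_sub_le (D.measure_ne_zero t) (D.measure_ne_top t) (hf t) c)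
      simpa [Measure.real] using h
    · intro t
      have h := ENNReal.toReal_mono
        (ENNReal.mul_ne_top ENNReal.ofReal_ne_top (D.measure_ne_top t)) (hBMO t)
      simpa [Measure.real, ENNReal.toReal_ofReal hB.le] using h
  have htend : TendstoInMeasure (ν.restrict (D.S t)) (fun n => D.approx f n t) Filter.atTop f := by
    refine tendstoInMeasure_of_tendsto_eLpNorm one_ne_zero
      (fun n => (D.measurable_approx f n t).aestronglyMeasurable) hfm.aestronglyMeasurable ?_
    simp only [eLpNorm_one_eq_lintegral_enorm, Pi.sub_apply]
    exact D.tendsto_lintegral_sub_approx t (hf t)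
  obtain ⟨ns, -, hae⟩ := htend.exists_seq_tendsto_ae
  have hmeas : ∀ k, Measurable fun x =>
      ENNReal.ofReal (Real.exp (l * ‖D.approx f (ns k) t x - avg t‖)) := fun k =>
    (Real.measurable_exp.comp ((((D.measurable_approx f (ns k) t).sub_const _).norm).const_mul
      l)).ennreal_ofReal
  calc ∫⁻ x in D.S t, ENNReal.ofReal (Real.exp (l * ‖f x - avg t‖)) ∂ν
      = ∫⁻ x in D.S t, Filter.liminf (fun k =>
          ENNReal.ofReal (Real.exp (l * ‖D.approx f (ns k) t x - avg t‖))) Filter.atTop ∂ν := by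
        refine lintegral_congr_ae ?_
        filter_upwards [hae] with x hx
        refine (Filter.Tendsto.liminf_eq ?_).symm
        refine ENNReal.tendsto_ofReal ((Real.continuous_exp.tendsto _).comp ?_)
        exact ((hx.sub_const _).norm).const_mul l
    _ ≤ _ := lintegral_liminf_le hmeas
    _ ≤ _ := Filter.liminf_le_of_frequently_le' (Filter.Frequently.of_forall fun k => hbound _)

end PartitionTree

/-- The half-open cube with corner `a` and side length `h`. -/
def cube {n : ℕ} (a : Fin n → ℝ) (h : ℝ) : Set (Fin n → ℝ) :=
  univ.pi fun i => Ioc (a i) (a i + h)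

/-- The corner of the dyadic child of `cube a h` indexed by `s`. -/
def childCorner {n : ℕ} (a : Fin n → ℝ) (h : ℝ) (s : Fin n → Bool) : Fin n → ℝ :=
  fun i => a i + if s i then h / 2 else 0

lemma measurableSet_cube {n : ℕ} (a : Fin n → ℝ) (h : ℝ) : MeasurableSet (cube a h) :=
  MeasurableSet.univ_pi fun _ => measurableSet_Ioc

lemma volume_cube {n : ℕ} (a : Fin n → ℝ) (h : ℝ) :
    volume (cube a h) = ENNReal.ofReal h ^ n := by
  simp [cube, Real.volume_pi_Ioc]

lemma mem_cube_child_iff {n : ℕ} {a : Fin n → ℝ} {h : ℝ} (hh : 0 < h) {s : Fin n → Bool}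
    {x : Fin n → ℝ} :
    x ∈ cube (childCorner a h s) (h / 2) ↔
      x ∈ cube a h ∧ s = fun i => decide (a i + h / 2 < x i) := by
  simp only [cube, childCorner, mem_univ_pi, mem_Ioc, funext_iff, ← forall_and]
  refine forall_congr' fun i => ?_
  cases hs : s i
  · simp only [Bool.false_eq_true, if_false, add_zero, false_eq_decide_iff, not_lt]
    constructor
    · rintro ⟨h1, h2⟩; exact ⟨⟨h1, by linarith⟩, h2⟩
    · rintro ⟨⟨h1, -⟩, h2⟩; exact ⟨h1, h2⟩
  · simp only [if_true, true_eq_decide_iff]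
    constructor
    · rintro ⟨h1, h2⟩; exact ⟨⟨by linarith, by linarith⟩, h1⟩
    · rintro ⟨⟨-, h1⟩, h2⟩; exact ⟨h2, by linarith⟩

lemma dist_le_of_mem_cube {n : ℕ} {a : Fin n → ℝ} {h : ℝ} (hh : 0 ≤ h) {x y : Fin n → ℝ}
    (hx : x ∈ cube a h) (hy : y ∈ cube a h) : dist x y ≤ h := by
  refine (dist_pi_le_iff hh).2 fun i => ?_
  have h1 := hx i (mem_univ i)
  have h2 := hy i (mem_univ i)
  rw [Real.dist_eq, abs_le]
  constructor <;> linarith [h1.1, h1.2, h2.1, h2.2]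

/-- Rectangles `cube a h ×ˢ cube b k` of nonzero `ν`-measure. -/
structure Rect (n₁ n₂ : ℕ) (ν : Measure ((Fin n₁ → ℝ) × (Fin n₂ → ℝ))) where
  a : Fin n₁ → ℝ
  h : ℝ
  b : Fin n₂ → ℝ
  k : ℝ
  h_pos : 0 < h
  k_pos : 0 < k
  measure_ne_zero : ν (cube a h ×ˢ cube b k) ≠ 0

section Rectangles

variable {n₁ n₂ : ℕ}

lemma cube_prod_mem_rects (a : Fin n₁ → ℝ) {h : ℝ} (hh : 0 < h) (b : Fin n₂ → ℝ) {k : ℝ}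
    (hk : 0 < k) : cube a h ×ˢ cube b k ∈ rects n₁ n₂ :=
  ⟨_, _, ⟨a, h, hh, rfl⟩, ⟨b, k, hk, rfl⟩, rfl⟩

lemma volume_cube_prod (a : Fin n₁ → ℝ) (h : ℝ) (b : Fin n₂ → ℝ) (k : ℝ) :
    volume (cube a h ×ˢ cube b k) = ENNReal.ofReal h ^ n₁ * ENNReal.ofReal k ^ n₂ := by
  rw [Measure.volume_eq_prod, Measure.prod_prod, volume_cube, volume_cube]

lemma child_subset (a : Fin n₁ → ℝ) {h : ℝ} (hh : 0 < h) (b : Fin n₂ → ℝ) {k : ℝ}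
    (hk : 0 < k) (s : Fin n₁ → Bool) (r : Fin n₂ → Bool) :
    cube (childCorner a h s) (h / 2) ×ˢ cube (childCorner b k r) (k / 2) ⊆
      cube a h ×ˢ cube b k :=
  prod_mono (fun _ hx => ((mem_cube_child_iff hh).1 hx).1)
    fun _ hx => ((mem_cube_child_iff hk).1 hx).1

/-- `A_p` weights are doubling with respect to dyadic children of rectangles. -/
lemma exists_doubling {w : (Fin n₁ → ℝ) × (Fin n₂ → ℝ) → ℝ≥0∞}
    (hw : MemAinfty volume (rects n₁ n₂) w) :
    ∃ C : ℝ, 0 ≤ C ∧ ∀ (a : Fin n₁ → ℝ) (h : ℝ) (b : Fin n₂ → ℝ) (k : ℝ), 0 < h → 0 < k →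
      ∀ (s : Fin n₁ → Bool) (r : Fin n₂ → Bool),
        (volume.withDensity w) (cube a h ×ˢ cube b k) ≤ ENNReal.ofReal C *
          (volume.withDensity w)
            (cube (childCorner a h s) (h / 2) ×ˢ cube (childCorner b k r) (k / 2)) := by
  obtain ⟨p, hp, hwm, hwfin, hA⟩ := hw
  set A := apConst volume (rects n₁ n₂) p w
  have hNp : A * ((2 : ℝ≥0∞) ^ (n₁ + n₂)) ^ p ≠ ⊤ := by
    have := hA.ne
    have : 0 ≤ p := by linarith
    finiteness
  refine ⟨(A * ((2 : ℝ≥0∞) ^ (n₁ + n₂)) ^ p).toReal, ENNReal.toReal_nonneg, ?_⟩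
  intro a h b k hh hk s r
  have hR := cube_prod_mem_rects a hh b hk
  have half : ∀ {x : ℝ}, ENNReal.ofReal x = 2 * ENNReal.ofReal (x / 2) := fun {x} => by
    rw [← ENNReal.ofReal_ofNat, ← ENNReal.ofReal_mul (by norm_num)]
    congr 1; ring
  rw [ENNReal.ofReal_toReal hNp,
    withDensity_apply _ ((measurableSet_cube _ _).prod (measurableSet_cube _ _)),
    withDensity_apply _ ((measurableSet_cube _ _).prod (measurableSet_cube _ _))]
  refine weight_le_of_apConst hwm hp (child_subset a hh b hk s r) ?_ ?_ ?_ (hwfin _ hR) ?_ hA.ne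
  · rw [volume_cube_prod, volume_cube_prod, half (x := h), half (x := k)]
    ring
  · rw [volume_cube_prod]
    have h1 : ENNReal.ofReal (h / 2) ≠ 0 := by simpa using hh
    have h2 : ENNReal.ofReal (k / 2) ≠ 0 := by simpa using hk
    exact mul_ne_zero (pow_ne_zero _ h1) (pow_ne_zero _ h2)
  · rw [volume_cube_prod]
    finiteness
  · exact le_iSup₂ (f := fun B (_ : B ∈ rects n₁ n₂) =>
      lavg volume B w * (lavg volume B fun x => w x ^ (-(conj p / p))) ^ (p / conj p)) _ hR

/-- The tree of dyadic subrectangles, for a doubling measure. -/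
def rectTree (ν : Measure ((Fin n₁ → ℝ) × (Fin n₂ → ℝ))) (C : ℝ)
    (hfin : ∀ R ∈ rects n₁ n₂, ν R ≠ ⊤)
    (hC : ∀ (a : Fin n₁ → ℝ) (h : ℝ) (b : Fin n₂ → ℝ) (k : ℝ), 0 < h → 0 < k →
      ∀ (s : Fin n₁ → Bool) (r : Fin n₂ → Bool),
        ν (cube a h ×ˢ cube b k) ≤ ENNReal.ofReal C *
          ν (cube (childCorner a h s) (h / 2) ×ˢ cube (childCorner b k r) (k / 2))) :
    PartitionTree ((Fin n₁ → ℝ) × (Fin n₂ → ℝ)) ν (Rect n₁ n₂ ν)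
      ((Fin n₁ → Bool) × (Fin n₂ → Bool)) where
  S t := cube t.a t.h ×ˢ cube t.b t.k
  child t i :=
    { a := childCorner t.a t.h i.1
      h := t.h / 2
      b := childCorner t.b t.k i.2
      k := t.k / 2
      h_pos := half_pos t.h_pos
      k_pos := half_pos t.k_pos
      measure_ne_zero := fun h0 => t.measure_ne_zero <| by
        simpa [h0] using hC t.a t.h t.b t.k t.h_pos t.k_pos i.1 i.2 }
  size t := max t.h t.k
  measurableSet t := (measurableSet_cube _ _).prod (measurableSet_cube _ _)
  eq_iUnion t := by
    ext x
    simp only [mem_iUnion, mem_prod, mem_cube_child_iff t.h_pos, mem_cube_child_iff t.k_pos]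
    constructor
    · exact fun hx => ⟨(_, _), ⟨hx.1, rfl⟩, ⟨hx.2, rfl⟩⟩
    · exact fun ⟨_, h1, h2⟩ => ⟨h1.1, h2.1⟩
  disjoint t i j hij := by
    refine Set.disjoint_left.2 fun x hx hy => hij ?_
    simp only [mem_prod, mem_cube_child_iff t.h_pos, mem_cube_child_iff t.k_pos] at hx hy
    exact Prod.ext (hx.1.2.trans hy.1.2.symm) (hx.2.2.trans hy.2.2.symm)
  dist_le t x hx y hy := max_le_max (dist_le_of_mem_cube t.h_pos.le hx.1 hy.1)
    (dist_le_of_mem_cube t.k_pos.le hx.2 hy.2)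
  size_child t i := (max_div_div_right (by norm_num) _ _)
  measure_ne_zero t := t.measure_ne_zero
  measure_ne_top t := hfin _ (cube_prod_mem_rects _ t.h_pos _ t.k_pos)

end Rectangles

end JNW

/-- **Lemma 5.8 (John–Nirenberg inequality for little `bmo`).**  Let
`w ∈ A_∞(ℝ^{n₁}×ℝ^{n₂})`.  There exists `η > 0` (depending on `w`) such that
`sup_{R∈ℛ} (1/w(R)) ∫_R exp(|f - f_{w,R}|/(η‖f‖_{bmo_w})) w dx < ∞`
for all `f ∈ bmo_w` with `‖f‖_{bmo_w} > 0`. -/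
theorem statement15
    (n₁ n₂ : ℕ) (w : (Fin n₁ → ℝ) × (Fin n₂ → ℝ) → ℝ≥0∞)
    (hw : JNW.MemAinfty volume (JNW.rects n₁ n₂) w) :
    ∃ η : ℝ, 0 < η ∧
      ∀ f : (Fin n₁ → ℝ) × (Fin n₂ → ℝ) → ℂ, Measurable f →
        (∀ R ∈ JNW.rects n₁ n₂, ∫⁻ x in R, (‖f x‖₊ : ℝ≥0∞) * w x < ⊤) →
        JNW.bmoRectWNorm n₁ n₂ w f < ⊤ → 0 < JNW.bmoRectWNorm n₁ n₂ w f →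
        (⨆ R ∈ JNW.rects n₁ n₂,
          (∫⁻ x in R,
            ENNReal.ofReal
              (Real.exp (‖f x - ⨍ y in R, f y ∂(volume.withDensity w)‖ /
                (η * (JNW.bmoRectWNorm n₁ n₂ w f).toReal))) * w x) /
            ∫⁻ x in R, w x) < ⊤ := by
  obtain ⟨C, hC0, hC⟩ := JNW.exists_doubling hw
  obtain ⟨p, -, hwm, hwfin, -⟩ := hw
  refine ⟨3 * (2 + C), by positivity, fun f hfm hf hbt hb0 => ?_⟩
  set ν := volume.withDensity w with hν
  have hRm : ∀ R ∈ JNW.rects n₁ n₂, MeasurableSet R := by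
    rintro _ ⟨_, _, ⟨a, h, -, rfl⟩, ⟨b, k, -, rfl⟩, rfl⟩
    exact (JNW.measurableSet_cube a h).prod (JNW.measurableSet_cube b k)
  have hνR : ∀ R ∈ JNW.rects n₁ n₂, ∫⁻ x in R, w x = ν R := fun R hR =>
    (withDensity_apply w (hRm R hR)).symm
  have hνint : ∀ R ∈ JNW.rects n₁ n₂, ∀ g : (Fin n₁ → ℝ) × (Fin n₂ → ℝ) → ℝ≥0∞,
      Measurable g → ∫⁻ x in R, g x * w x = ∫⁻ x in R, g x ∂ν := by
    intro R hR g hg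
    rw [hν, setLIntegral_withDensity_eq_setLIntegral_mul _ hwm hg (hRm R hR)]
    exact lintegral_congr fun x => mul_comm _ _
  have hfin : ∀ R ∈ JNW.rects n₁ n₂, ν R ≠ ⊤ := fun R hR => by
    rw [← hνR R hR]; exact (hwfin R hR).ne
  set N := JNW.bmoRectWNorm n₁ n₂ w f with hN
  set B := N.toReal
  have hB : 0 < B := ENNReal.toReal_pos hb0.ne' hbt.ne
  have hBN : ENNReal.ofReal B = N := ENNReal.ofReal_toReal hbt.ne
  have hl : 1 / (3 * (2 + C) * B) * (3 * (2 + C) * B) = 1 := by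
    field_simp
  set l := 1 / (3 * (2 + C) * B) with hldef
  refine lt_of_le_of_lt (iSup₂_le fun R hR => ?_)
    (ENNReal.ofReal_lt_top (r := 4 * Real.exp (l * (2 * B))))
  have hexp : Measurable fun x => ENNReal.ofReal
      (Real.exp (‖f x - ⨍ y in R, f y ∂ν‖ / (3 * (2 + C) * B))) :=
    (Real.measurable_exp.comp ((hfm.sub_const _).norm.div_const _)).ennreal_ofReal
  rw [hνR R hR, hνint R hR _ hexp]
  by_cases h0 : ν R = 0
  · rw [Measure.restrict_eq_zero.2 h0]
    simp
  refine ENNReal.div_le_of_le_mul ?_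
  obtain ⟨_, _, ⟨a, h, hh, rfl⟩, ⟨b, k, hk, rfl⟩, rfl⟩ := hR
  have hmem : ∀ t : JNW.Rect n₁ n₂ ν,
      JNW.cube t.a t.h ×ˢ JNW.cube t.b t.k ∈ JNW.rects n₁ n₂ := fun t =>
    JNW.cube_prod_mem_rects _ t.h_pos _ t.k_pos
  have key := (JNW.rectTree ν C hfin hC).lintegral_exp_le hfm (l := l) (fun t => ?_) hB hC0
    (fun t i => hC t.a t.h t.b t.k t.h_pos t.k_pos i.1 i.2) (fun t => ?_) hl
    ⟨a, h, b, k, hh, hk, h0⟩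
  · refine le_trans (le_of_eq ?_) key
    refine lintegral_congr fun x => ?_
    rw [hldef, one_div, div_eq_inv_mul]
    rfl
  · refine ⟨hfm.aestronglyMeasurable, ?_⟩
    have h1 := hf _ (hmem t)
    rw [hνint _ (hmem t) _ hfm.nnnorm.coe_nnreal_ennreal] at h1
    exact h1
  · rw [hBN]
    have h1 := le_iSup₂ (f := fun R (_ : R ∈ JNW.rects n₁ n₂) =>
      (∫⁻ x in R, (‖f x - ⨍ y in R, f y ∂ν‖₊ : ℝ≥0∞) * w x) / ∫⁻ x in R, w x) _ (hmem t)
    rw [hνint _ (hmem t) _ (hfm.sub_const _).nnnorm.coe_nnreal_ennreal, hνR _ (hmem t)] at h1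
    exact (ENNReal.div_le_iff t.measure_ne_zero (hfin _ (hmem t))).1 h1
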